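/- Let n ≥ 2 and let U ⊆ ℂⁿ be an open set. Let ξ, η : U → ℂⁿ be holomorphic maps with trace(Dξ(w)) = 0 and trace(Dη(w)) = 0 for all w ∈ U, and let f, g : U → ℂ be holomorphic functions such that Df(w)(ξ(w)) = 0 and Dg(w)(η(w)) = 0 for all w ∈ U (f is constant along ξ and g is constant along η). Let κ = [fξ, gη], i.e., κ(w) = D(gη)(w)((fξ)(w)) − D(fξ)(w)((gη)(w)), where (fξ)(w) = f(w)·ξ(w) and (gη)(w) = g(w)·η(w). Then for every w ∈ U and all v₁, …, v_{n−1} ∈ ℂⁿ one has det(κ(w), v₁, …, v_{n−1}) = Σ_{i=1}^{n−1} (−1)^{i+1} · D_{v_i}[ w' ↦ f(w')·g(w')·det(η(w'), ξ(w'), v₁, …, v_{i−1}, v_{i+1}, …, v_{n−1}) ](w). (This is the identity ι_{[fξ,gη]}ω = d((fg)·ι_ξ ι_η ω) for the standard volume form ω, used in Corollary 3.4 of the paper.) -/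

import Mathlib

open scoped BigOperators

/-- Determinant of the `n × n` complex matrix whose columns are `c 0, …, c (n-1)`. -/
noncomputable def colDet {n : ℕ} (c : Fin n → (Fin n → ℂ)) : ℂ :=
  Matrix.det (Matrix.of fun i j => c j i)

lemma colDet_eq {n : ℕ} (c : Fin n → (Fin n → ℂ)) :
    colDet c = (Matrix.detRowAlternating : (Fin n → ℂ) [⋀^Fin n]→ₗ[ℂ] ℂ) c := by
  unfold colDet
  rw [← Matrix.det_transpose]
  rfl

lemma colDet_trace {n : ℕ} (u : Fin n → (Fin n → ℂ)) (B : (Fin n → ℂ) →ₗ[ℂ] (Fin n → ℂ)) :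
    ∑ j, colDet (Function.update u j (B (u j))) = LinearMap.trace ℂ _ B * colDet u := by
  set M : Matrix (Fin n) (Fin n) ℂ := Matrix.of fun i j => u j i with hM
  have h1 : ∀ j, colDet (Function.update u j (B (u j))) =
      (M.adjugate * (LinearMap.toMatrix' B * M)) j j := by
    intro j
    have h2 : colDet (Function.update u j (B (u j))) = (M.updateCol j (B (u j))).det := by
      unfold colDet
      congr 1
      ext i k
      by_cases h : k = j
      · subst h; simp
      · simp [h, hM]
    rw [h2, ← Matrix.cramer_apply, Matrix.cramer_eq_adjugate_mulVec,
      ← LinearMap.toMatrix'_mulVec B]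
    rfl
  have h3 : ∑ j, colDet (Function.update u j (B (u j))) =
      (M.adjugate * (LinearMap.toMatrix' B * M)).trace := by
    rw [Matrix.trace]; exact Finset.sum_congr rfl fun j _ => h1 j
  rw [h3, Matrix.trace_mul_comm, Matrix.mul_assoc, Matrix.mul_adjugate]
  rw [LinearMap.trace_eq_matrix_trace ℂ (Pi.basisFun ℂ (Fin n))]
  simp [colDet, hM, LinearMap.toMatrix_eq_toMatrix', mul_comm]

lemma colDet_insertNth {n : ℕ} (p : Fin (n+1)) (b : Fin (n+1) → ℂ) (v : Fin n → (Fin (n+1) → ℂ)) :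
    colDet (p.insertNth b v : Fin (n+1) → (Fin (n+1) → ℂ)) =
      (-1) ^ (p : ℕ) * colDet (Fin.cons b v) := by
  rw [colDet_eq, colDet_eq, AlternatingMap.map_insertNth]
  simp [Matrix.vecCons]

lemma cons_update_insertNth {m : ℕ} {E : Type*} (x b : E) (v : Fin (m+1) → E) (i : Fin (m+1)) :
    Function.update (Fin.cons x v : Fin (m+2) → E) i.succ b =
      i.succ.insertNth b (Fin.cons x (fun j : Fin m => v (i.succAbove j)) : Fin (m+1) → E) := by
  rw [← Fin.insertNth_removeNth]
  congr 1
  ext j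
  refine Fin.cases ?_ (fun j => ?_) j <;> simp [Fin.removeNth]

lemma colDet_swap01 {m : ℕ} (x y : Fin (m+2) → ℂ) (v : Fin m → (Fin (m+2) → ℂ)) :
    colDet (Fin.cons x (Fin.cons y v)) = - colDet (Fin.cons y (Fin.cons x v)) := by
  have h := cons_update_insertNth y x (Fin.cons x v : Fin (m+1) → (Fin (m+2) → ℂ)) 0
  simp only [← Fin.cons_update, Fin.update_cons_zero, Fin.succAbove_zero, Fin.cons_succ] at h
  rw [h, colDet_insertNth]
  simp

lemma colDet_move {m : ℕ} (x : Fin (m+2) → ℂ) (v : Fin (m+1) → (Fin (m+2) → ℂ))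
    (B : (Fin (m+2) → ℂ) →ₗ[ℂ] (Fin (m+2) → ℂ)) (hB : LinearMap.trace ℂ _ B = 0) :
    colDet (Fin.cons (B x) v) = ∑ i : Fin (m+1), (-1) ^ (i : ℕ) *
      colDet (Fin.cons (B (v i)) (Fin.cons x (fun j : Fin m => v (i.succAbove j)))) := by
  have h := colDet_trace (Fin.cons x v : Fin (m+2) → _) B
  rw [hB, zero_mul, Fin.sum_univ_succ] at h
  simp only [Fin.cons_zero, Fin.cons_succ, cons_update_insertNth, colDet_insertNth,
    Fin.update_cons_zero] at h
  rw [eq_neg_of_add_eq_zero_left h, ← Finset.sum_neg_distrib]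
  refine Finset.sum_congr rfl fun i _ => ?_
  rw [Fin.val_succ, pow_succ]; ring

lemma colDet_fderiv {m : ℕ} (X Y : (Fin (m+2) → ℂ) → (Fin (m+2) → ℂ)) (w : Fin (m+2) → ℂ)
    (hX : DifferentiableAt ℂ X w) (hY : DifferentiableAt ℂ Y w)
    (r : Fin m → (Fin (m+2) → ℂ)) (z : Fin (m+2) → ℂ) :
    fderiv ℂ (fun w' => colDet (Fin.cons (Y w') (Fin.cons (X w') r))) w z =
      colDet (Fin.cons (fderiv ℂ Y w z) (Fin.cons (X w) r)) +
      colDet (Fin.cons (Y w) (Fin.cons (fderiv ℂ X w z) r)) := by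
  let D : ContinuousMultilinearMap ℂ (fun _ : Fin (m+2) => (Fin (m+2) → ℂ)) ℂ :=
    ⟨(Matrix.detRowAlternating : (Fin (m+2) → ℂ) [⋀^Fin (m+2)]→ₗ[ℂ] ℂ).toMultilinearMap,
      Continuous.matrix_det continuous_id⟩
  have hD : ∀ c, colDet c = D c := fun c => colDet_eq c
  let G' : Fin (m+2) → ((Fin (m+2) → ℂ) →L[ℂ] (Fin (m+2) → ℂ)) :=
    Fin.cons (fderiv ℂ Y w) (Fin.cons (fderiv ℂ X w) 0)
  let G : Fin (m+2) → (Fin (m+2) → ℂ) → (Fin (m+2) → ℂ) :=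
    fun i w' => (Fin.cons (Y w') (Fin.cons (X w') r) : Fin (m+2) → (Fin (m+2) → ℂ)) i
  have hG : ∀ i, HasFDerivAt (G i) (G' i) w := by
    intro i
    refine Fin.cases ?_ (fun j => ?_) i
    · exact hY.hasFDerivAt
    · refine Fin.cases ?_ (fun j => ?_) j
      · exact hX.hasFDerivAt
      · exact hasFDerivAt_const _ _
  have h := HasFDerivAt.multilinear_comp (f := D) hG
  have h2 : fderiv ℂ (fun w' => colDet (Fin.cons (Y w') (Fin.cons (X w') r))) w = _ :=
    (h.congr_of_eventuallyEq (Filter.Eventually.of_forall fun w' => hD _)).fderiv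
  rw [h2, Fin.sum_univ_succ, Fin.sum_univ_succ]
  have e : ∀ j : Fin m, G' j.succ.succ = 0 := fun j => rfl
  have e0 : G' 0 = fderiv ℂ Y w := rfl
  have e1 : G' (Fin.succ 0) = fderiv ℂ X w := rfl
  have eG : (fun i => G i w) = (Fin.cons (Y w) (Fin.cons (X w) r) : Fin (m+2) → _) := rfl
  simp only [e, e0, e1, eG, hD, ContinuousLinearMap.comp_zero, Finset.sum_const_zero, add_zero,
    ContinuousLinearMap.add_apply, ContinuousLinearMap.comp_apply,
    ContinuousMultilinearMap.toContinuousLinearMap_apply, Fin.update_cons_zero,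
    ← Fin.cons_update]

lemma trace_smul_field {n : ℕ} (f : (Fin n → ℂ) → ℂ) (X : (Fin n → ℂ) → (Fin n → ℂ))
    (w : Fin n → ℂ) (hf : DifferentiableAt ℂ f w) (hX : DifferentiableAt ℂ X w)
    (ht : LinearMap.trace ℂ (Fin n → ℂ) (fderiv ℂ X w).toLinearMap = 0)
    (h0 : fderiv ℂ f w (X w) = 0) :
    LinearMap.trace ℂ (Fin n → ℂ) (fderiv ℂ (fun w' => f w' • X w') w).toLinearMap = 0 := by
  have h : (fderiv ℂ (fun w' => f w' • X w') w).toLinearMap =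
      f w • (fderiv ℂ X w).toLinearMap + (fderiv ℂ f w).toLinearMap.smulRight (X w) := by
    rw [fderiv_fun_smul hf hX]
    rfl
  rw [h, map_add, map_smul, ht, LinearMap.trace_smulRight]
  simpa using h0

lemma colDet_smul2 {m : ℕ} (a b : ℂ) (x y : Fin (m+2) → ℂ) (r : Fin m → (Fin (m+2) → ℂ)) :
    colDet (Fin.cons (b • y) (Fin.cons (a • x) r)) =
      a * b * colDet (Fin.cons y (Fin.cons x r)) := by
  have key : ∀ (c : ℂ) (y : Fin (m+2) → ℂ) (u : Fin (m+1) → (Fin (m+2) → ℂ)),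
      colDet (Fin.cons (c • y) u) = c * colDet (Fin.cons y u) := by
    intro c y u
    rw [colDet_eq, colDet_eq]
    exact MultilinearMap.cons_smul
      (Matrix.detRowAlternating : (Fin (m+2) → ℂ) [⋀^Fin (m+2)]→ₗ[ℂ] ℂ).toMultilinearMap u c y
  rw [key, colDet_swap01, key, colDet_swap01]
  ring

/-- Coordinate form of `ι_{[fξ, gη]} ω = d ((fg) · ι_ξ ι_η ω)` for the standard volume
form `ω = dz₁ ∧ … ∧ dzₙ` on `ℂⁿ` (here `n = m + 2 ≥ 2`), holomorphic divergence-free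
vector fields `ξ`, `η` on an open set `U ⊆ ℂⁿ`, and holomorphic functions `f`, `g`
with `f` constant along `ξ` and `g` constant along `η`. -/
theorem stmt1 (m : ℕ) (U : Set (Fin (m + 2) → ℂ)) (hU : IsOpen U)
    (ξ η : (Fin (m + 2) → ℂ) → (Fin (m + 2) → ℂ)) (f g : (Fin (m + 2) → ℂ) → ℂ)
    (hξ : ∀ w ∈ U, DifferentiableAt ℂ ξ w)
    (hη : ∀ w ∈ U, DifferentiableAt ℂ η w)
    (hf : ∀ w ∈ U, DifferentiableAt ℂ f w)
    (hg : ∀ w ∈ U, DifferentiableAt ℂ g w)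
    (hdivξ : ∀ w ∈ U,
      LinearMap.trace ℂ (Fin (m + 2) → ℂ) (fderiv ℂ ξ w).toLinearMap = 0)
    (hdivη : ∀ w ∈ U,
      LinearMap.trace ℂ (Fin (m + 2) → ℂ) (fderiv ℂ η w).toLinearMap = 0)
    (hfξ : ∀ w ∈ U, fderiv ℂ f w (ξ w) = 0)
    (hgη : ∀ w ∈ U, fderiv ℂ g w (η w) = 0)
    (w : Fin (m + 2) → ℂ) (hw : w ∈ U) (v : Fin (m + 1) → (Fin (m + 2) → ℂ)) :
    colDet (Fin.cons
        (fderiv ℂ (fun w' => g w' • η w') w (f w • ξ w) -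
          fderiv ℂ (fun w' => f w' • ξ w') w (g w • η w)) v) =
      ∑ i : Fin (m + 1), (-1 : ℂ) ^ (i : ℕ) *
        fderiv ℂ (fun w' => f w' * g w' * colDet (Fin.cons (η w')
          (Fin.cons (ξ w') (fun j : Fin m => v (i.succAbove j))))) w (v i) := by
  have hX : DifferentiableAt ℂ (fun w' => f w' • ξ w') w := (hf w hw).smul (hξ w hw)
  have hY : DifferentiableAt ℂ (fun w' => g w' • η w') w := (hg w hw).smul (hη w hw)
  have tX := trace_smul_field f ξ w (hf w hw) (hξ w hw) (hdivξ w hw) (hfξ w hw)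
  have tY := trace_smul_field g η w (hg w hw) (hη w hw) (hdivη w hw) (hgη w hw)
  simp only [← colDet_smul2]
  have hd := fun r z => colDet_fderiv (fun w' => f w' • ξ w') (fun w' => g w' • η w') w hX hY r z
  simp only [hd]
  have mY := colDet_move (f w • ξ w) v _ tY
  have mX := colDet_move (g w • η w) v _ tX
  have hsub : ∀ a b : Fin (m+2) → ℂ,
      colDet (Fin.cons (a - b) v) = colDet (Fin.cons a v) - colDet (Fin.cons b v) := by
    intro a b
    have := MultilinearMap.cons_add
      (Matrix.detRowAlternating : (Fin (m+2) → ℂ) [⋀^Fin (m+2)]→ₗ[ℂ] ℂ).toMultilinearMap v (a - b) b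
    rw [sub_add_cancel] at this
    rw [colDet_eq, colDet_eq, colDet_eq]
    exact eq_sub_of_add_eq this.symm
  rw [hsub]
  refine (congrArg₂ (· - ·) mY mX).trans ?_
  simp only [← Finset.sum_sub_distrib]
  refine Finset.sum_congr rfl fun i _ => ?_
  rw [colDet_swap01 ((fderiv ℂ (fun w' => f w' • ξ w') w).toLinearMap (v i))]
  simp only [ContinuousLinearMap.coe_coe]
  ring
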